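/- Fix N ≥ 1, p_A = 1/2, and game-B parameters of the form {p1, p2, p3} = {p1, 1/2, 1-p1} with p1 ∈ (0,1). Then for every mixing probability γ ∈ [0,1]: a_{N-i} = 1 - a_i for all i, and the unnormalized stationary weights are symmetric, Π_i = Π_{N-i}, for all i ∈ {0,...,N}; hence (for Z > 0) P^st_i = P^st_{N-i}. -/

import Mathlib

open Finset

/-- Winning probability of game B at state `i` for parameters `p1, p2, p3`,
with `round x` the nearest integer to `x`. -/
noncomputable def gameB (N : ℕ) (p1 p2 p3 : ℝ) (i : ℕ) : ℝ :=
  if round ((2 * N : ℝ) / 3) < (i : ℤ) then p1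
  else if round ((N : ℝ) / 3) ≤ (i : ℤ) then p2
  else p3

/-- `a i = γ·pA + (1-γ)·p^B_i`. -/
noncomputable def aProb (N : ℕ) (pA p1 p2 p3 γ : ℝ) (i : ℕ) : ℝ :=
  γ * pA + (1 - γ) * gameB N p1 p2 p3 i

/-- Forward transition probability `p_i = ((N-i)/N)·a_i`. -/
noncomputable def fwd (N : ℕ) (pA p1 p2 p3 γ : ℝ) (i : ℕ) : ℝ :=
  (((N : ℝ) - (i : ℝ)) / (N : ℝ)) * aProb N pA p1 p2 p3 γ i

/-- Backward transition probability `q_i = (i/N)·(1-a_i)`. -/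
noncomputable def bwd (N : ℕ) (pA p1 p2 p3 γ : ℝ) (i : ℕ) : ℝ :=
  ((i : ℝ) / (N : ℝ)) * (1 - aProb N pA p1 p2 p3 γ i)

/-- Staying probability `r_i = 1 - p_i - q_i`. -/
noncomputable def stay (N : ℕ) (pA p1 p2 p3 γ : ℝ) (i : ℕ) : ℝ :=
  1 - fwd N pA p1 p2 p3 γ i - bwd N pA p1 p2 p3 γ i

/-- Unnormalized stationary weight `Π_i = (∏_{j=0}^{i-1} p_j)·(∏_{j=i+1}^{N} q_j)`. -/
noncomputable def wt (N : ℕ) (pA p1 p2 p3 γ : ℝ) (i : ℕ) : ℝ :=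
  (∏ j ∈ Finset.range i, fwd N pA p1 p2 p3 γ j) *
    (∏ j ∈ Finset.Icc (i + 1) N, bwd N pA p1 p2 p3 γ j)

/-- Normalization `Z = Σ_{i=0}^{N} Π_i`. -/
noncomputable def Znorm (N : ℕ) (pA p1 p2 p3 γ : ℝ) : ℝ :=
  ∑ i ∈ Finset.range (N + 1), wt N pA p1 p2 p3 γ i

/-- Stationary probability `P^st_i = Π_i / Z`. -/
noncomputable def Pst (N : ℕ) (pA p1 p2 p3 γ : ℝ) (i : ℕ) : ℝ :=
  wt N pA p1 p2 p3 γ i / Znorm N pA p1 p2 p3 γ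

/-- Average winning probability `p_win = Σ_{i=0}^{N} a_i · P^st_i`. -/
noncomputable def pwin (N : ℕ) (pA p1 p2 p3 γ : ℝ) : ℝ :=
  ∑ i ∈ Finset.range (N + 1), aProb N pA p1 p2 p3 γ i * Pst N pA p1 p2 p3 γ i

/-- Current `J = 2·p_win - 1`. -/
noncomputable def current (N : ℕ) (pA p1 p2 p3 γ : ℝ) : ℝ :=
  2 * pwin N pA p1 p2 p3 γ - 1

theorem round_two_thirds_add_round_third (N : ℕ) :
    round ((2 * N : ℝ) / 3) + round ((N : ℝ) / 3) = N ∧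
      round ((N : ℝ) / 3) ≤ round ((2 * N : ℝ) / 3) := by
  rw [round_eq, round_eq]
  have h1 := Int.floor_le ((2 * N : ℝ) / 3 + 1 / 2)
  have h2 := Int.lt_floor_add_one ((2 * N : ℝ) / 3 + 1 / 2)
  have h3 := Int.floor_le ((N : ℝ) / 3 + 1 / 2)
  have h4 := Int.lt_floor_add_one ((N : ℝ) / 3 + 1 / 2)
  generalize ⌊(2 * N : ℝ) / 3 + 1 / 2⌋ = s at *
  generalize ⌊(N : ℝ) / 3 + 1 / 2⌋ = r at *
  have e1 : 6 * s ≤ 4 * (N : ℤ) + 3 := by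
    have : (6 * s : ℝ) ≤ 4 * N + 3 := by linarith
    exact_mod_cast this
  have e2 : 4 * (N : ℤ) + 3 < 6 * s + 6 := by
    have : (4 * N + 3 : ℝ) < 6 * s + 6 := by linarith
    exact_mod_cast this
  have e3 : 6 * r ≤ 2 * (N : ℤ) + 3 := by
    have : (6 * r : ℝ) ≤ 2 * N + 3 := by linarith
    exact_mod_cast this
  have e4 : 2 * (N : ℤ) + 3 < 6 * r + 6 := by
    have : (2 * N + 3 : ℝ) < 6 * r + 6 := by linarith
    exact_mod_cast this
  omega

theorem gameB_sub {N i : ℕ} (hi : i ≤ N) (p1 : ℝ) :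
    gameB N p1 (1 / 2) (1 - p1) (N - i) = 1 - gameB N p1 (1 / 2) (1 - p1) i := by
  obtain ⟨hsum, hle⟩ := round_two_thirds_add_round_third N
  unfold gameB
  split_ifs <;> first | omega | ring

theorem aProb_sub {N i : ℕ} (hi : i ≤ N) (p1 γ : ℝ) :
    aProb N (1 / 2) p1 (1 / 2) (1 - p1) γ (N - i) =
      1 - aProb N (1 / 2) p1 (1 / 2) (1 - p1) γ i := by
  unfold aProb
  rw [gameB_sub hi]
  ring

theorem bwd_sub {N i : ℕ} (hi : i ≤ N) (p1 γ : ℝ) :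
    bwd N (1 / 2) p1 (1 / 2) (1 - p1) γ (N - i) = fwd N (1 / 2) p1 (1 / 2) (1 - p1) γ i := by
  unfold bwd fwd
  rw [aProb_sub hi, Nat.cast_sub hi, sub_sub_cancel]

theorem prod_fwd_eq_prod_bwd {N i : ℕ} (hi : i ≤ N) (p1 γ : ℝ) :
    ∏ j ∈ range i, fwd N (1 / 2) p1 (1 / 2) (1 - p1) γ j =
      ∏ j ∈ Icc (N - i + 1) N, bwd N (1 / 2) p1 (1 / 2) (1 - p1) γ j := by
  refine prod_nbij' (fun j => N - j) (fun j => N - j) ?_ ?_ ?_ ?_ ?_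
  all_goals intro j hj; simp only [mem_range, mem_Icc] at hj ⊢
  · omega
  · omega
  · omega
  · omega
  · exact (bwd_sub (by omega) p1 γ).symm

theorem wt_sub {N i : ℕ} (hi : i ≤ N) (p1 γ : ℝ) :
    wt N (1 / 2) p1 (1 / 2) (1 - p1) γ i = wt N (1 / 2) p1 (1 / 2) (1 - p1) γ (N - i) := by
  unfold wt
  rw [prod_fwd_eq_prod_bwd hi, prod_fwd_eq_prod_bwd (Nat.sub_le N i), Nat.sub_sub_self hi,
    mul_comm]

/-- for `p_A = 1/2` and game-B parameters `{p1, 1/2, 1-p1}` with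
`p1 ∈ (0,1)`, for every `γ ∈ [0,1]` one has `a_{N-i} = 1 - a_i`, the weights are
symmetric `Π_i = Π_{N-i}`, and hence (for `Z > 0`) `P^st_i = P^st_{N-i}`. -/
theorem symmetric_weights (N : ℕ) (hN : 1 ≤ N) (p1 γ : ℝ)
    (hp1 : p1 ∈ Set.Ioo (0 : ℝ) 1) (hγ : γ ∈ Set.Icc (0 : ℝ) 1) :
    (∀ i ≤ N,
      aProb N (1 / 2) p1 (1 / 2) (1 - p1) γ (N - i) =
        1 - aProb N (1 / 2) p1 (1 / 2) (1 - p1) γ i) ∧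
    (∀ i ≤ N,
      wt N (1 / 2) p1 (1 / 2) (1 - p1) γ i = wt N (1 / 2) p1 (1 / 2) (1 - p1) γ (N - i)) ∧
    (0 < Znorm N (1 / 2) p1 (1 / 2) (1 - p1) γ →
      ∀ i ≤ N,
        Pst N (1 / 2) p1 (1 / 2) (1 - p1) γ i = Pst N (1 / 2) p1 (1 / 2) (1 - p1) γ (N - i)) := by
  refine ⟨fun i hi => aProb_sub hi p1 γ, fun i hi => wt_sub hi p1 γ, fun _ i hi => ?_⟩
  unfold Pst
  rw [wt_sub hi]
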